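/- arXiv:2508.00601 — 2 statements merged into one kernel-verified Lean document; each statement's English description precedes it below -/
import Mathlib

section
/- Let m = 2, so β is the golden ratio (β² = β + 1). For every probability weight p = (p₁, p₂), the self-similar measure μ_p is doubling if and only if p₁ = p₂ = 1/2. -/
open MeasureTheory

noncomputable section

/-- The contraction maps: `Smap β 0 = S₁ : x ↦ x/β` and `Smap β 1 = S₂ : x ↦ x/β + (1 - 1/β)`. -/
def Smap (β : ℝ) (i : Fin 2) (x : ℝ) : ℝ :=
  if i = 0 then x / β else x / β + (1 - 1 / β)

/-- `Sapply β I = S_I = S_{i₁} ∘ ⋯ ∘ S_{i_n}` for a word `I = i₁…i_n ∈ {1,2}^n`. -/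
def Sapply (β : ℝ) : {n : ℕ} → (Fin n → Fin 2) → ℝ → ℝ
  | 0, _, x => x
  | _+1, I, x => Smap β (I 0) (Sapply β (fun k => I k.succ) x)

/-- `Xn β n = {S_I(0) : I ∈ {1,2}^n} ∪ {1}`. -/
def Xn (β : ℝ) (n : ℕ) : Finset ℝ :=
  (Finset.univ.image fun I : Fin n → Fin 2 => Sapply β I 0) ∪ {1}

/-- `pt β n j = a_{n,j}`, the `j`-th element of `Xn β n` in increasing order
(junk value `0` if `j` is out of range). -/
def pt (β : ℝ) (n j : ℕ) : ℝ := ((Xn β n).sort (· ≤ ·)).getD j 0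

/-- The sequence `d₀ = 1`, `d₁ = β - 1`, `d_{j+1} = β·d_j - d₁`. -/
def dd (β : ℝ) : ℕ → ℝ
  | 0 => 1
  | 1 => β - 1
  | j+2 => β * dd β (j+1) - (β - 1)

/-- The weight of a letter: `pw p₁ p₂ i = p_{i+1}`. -/
def pw (p1 p2 : ℝ) (i : Fin 2) : ℝ := if i = 0 then p1 else p2

/-- `Wn β p₁ p₂ n x = W_n(x) = ∑_{S_I(0)=x, |I|=n} p_I`. -/
def Wn (β p1 p2 : ℝ) (n : ℕ) (x : ℝ) : ℝ :=
  ∑ I : Fin n → Fin 2, if Sapply β I 0 = x then ∏ k, pw p1 p2 (I k) else 0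

/-- A measure with support `[0,1]` is doubling if
`sup { μ(B(x,2r))/μ(B(x,r)) : x ∈ supp μ = [0,1], r > 0 } < ∞`. -/
def IsDoubling (μ : Measure ℝ) : Prop :=
  (⨆ (x : ℝ) (_ : x ∈ Set.Icc (0:ℝ) 1) (r : ℝ) (_ : 0 < r),
    μ (Metric.closedBall x (2 * r)) / μ (Metric.closedBall x r)) < ⊤

structure GM (ρ p1 p2 : ℝ) (m : ℝ → ℝ → ℝ) : Prop where
  hρ : 0 < ρ
  hρ1 : ρ < 1
  sq : ρ ^ 2 = 1 - ρ
  hp1 : 0 < p1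
  hp2 : 0 < p2
  hp : p1 + p2 = 1
  ss : ∀ u v, m (ρ * u) (ρ * v) = p1 * m u v + p2 * m (u - ρ) (v - ρ)
  z0 : ∀ u v, v ≤ 0 → m u v = 0
  z1 : ∀ u v, 1 ≤ u → m u v = 0
  nn : ∀ u v, 0 ≤ m u v
  mono : ∀ u v u' v', u' ≤ u → v ≤ v' → m u v ≤ m u' v'
  sub : ∀ u v w, m u w ≤ m u v + m v w
  one : m 0 1 = 1
  le1 : ∀ u v, m u v ≤ 1

def aa (ρ : ℝ) (m : ℝ → ℝ → ℝ) (u v : ℝ) : ℝ := m (ρ ^ 2 * u) (ρ ^ 2 * v)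
def cc (ρ : ℝ) (m : ℝ → ℝ → ℝ) (u v : ℝ) : ℝ := m (ρ ^ 2 * u + ρ) (ρ ^ 2 * v + ρ)

theorem GM.eval {ρ p1 p2 : ℝ} {m : ℝ → ℝ → ℝ} (h : GM ρ p1 p2 m) (x y u v u' v' : ℝ)
    (h1 : x = ρ * u) (h2 : y = ρ * v) (h3 : u' = u - ρ) (h4 : v' = v - ρ) :
    m x y = p1 * m u v + p2 * m u' v' := by
  subst h1 h2 h3 h4; exact h.ss u v

theorem GM.refl {ρ p1 p2 : ℝ} {m : ℝ → ℝ → ℝ} (h : GM ρ p1 p2 m) :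
    GM ρ p2 p1 (fun u v => m (1 - v) (1 - u)) where
  hρ := h.hρ
  hρ1 := h.hρ1
  sq := h.sq
  hp1 := h.hp2
  hp2 := h.hp1
  hp := by linarith [h.hp]
  ss := fun u v => by
    have hs := h.sq
    rw [h.eval (1 - ρ * v) (1 - ρ * u) (1 - (v - ρ)) (1 - (u - ρ)) (1 - v) (1 - u)
      (by linear_combination -hs) (by linear_combination -hs) (by ring) (by ring)]
    ring
  z0 := fun u v hv => h.z1 _ _ (by linarith)
  z1 := fun u v hv => h.z0 _ _ (by linarith)
  nn := fun u v => h.nn _ _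
  mono := fun u v u' v' h1 h2 => h.mono _ _ _ _ (by linarith) (by linarith)
  sub := fun u v w => by rw [add_comm]; exact h.sub _ _ _
  one := by simpa using h.one
  le1 := fun u v => h.le1 _ _

section
variable {ρ p1 p2 : ℝ} {m : ℝ → ℝ → ℝ}

theorem GM.a_eq (h : GM ρ p1 p2 m) (u v : ℝ) (hv : v ≤ 1) :
    aa ρ m u v = p1 * (p1 * m u v + p2 * m (u - ρ) (v - ρ)) := by
  unfold aa
  rw [h.eval _ _ (ρ * u) (ρ * v) (ρ * u - ρ) (ρ * v - ρ) (by ring) (by ring) rfl rfl,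
    h.ss, h.z0 (ρ * u - ρ) (ρ * v - ρ) (by nlinarith [h.hρ])]
  ring

theorem GM.c_eq (h : GM ρ p1 p2 m) (u v : ℝ) (hu : 0 ≤ u) :
    cc ρ m u v = p2 * (p2 * m u v + p1 * m (u + ρ) (v + ρ)) := by
  unfold cc
  have hs := h.sq
  rw [h.eval _ _ (ρ * u + 1) (ρ * v + 1) (ρ * u + 1 - ρ) (ρ * v + 1 - ρ)
      (by ring) (by ring) rfl rfl,
    h.eval (ρ * u + 1 - ρ) (ρ * v + 1 - ρ) (u + ρ) (v + ρ) u v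
      (by linear_combination -hs) (by linear_combination -hs) (by ring) (by ring),
    h.z1 (ρ * u + 1) (ρ * v + 1) (by nlinarith [h.hρ])]
  ring

theorem GM.t1 (h : GM ρ p1 p2 m) (u v : ℝ) :
    m (ρ ^ 3 * u + ρ ^ 2) (ρ ^ 3 * v + ρ ^ 2) = p2 * aa ρ m u v + p1 * cc ρ m u v := by
  unfold aa cc
  rw [h.eval _ _ (ρ ^ 2 * u + ρ) (ρ ^ 2 * v + ρ) (ρ ^ 2 * u) (ρ ^ 2 * v)
      (by ring) (by ring) (by ring) (by ring)]
  ring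

theorem GM.sq_lt (h : GM ρ p1 p2 m) : ρ ^ 2 < ρ := by nlinarith [h.hρ, h.hρ1]

theorem GM.a_t0 (h : GM ρ p1 p2 m) (u v : ℝ) (hv : v ≤ 1) :
    aa ρ m (ρ ^ 2 * u) (ρ ^ 2 * v) = p1 ^ 2 * aa ρ m u v := by
  have hl := h.sq_lt
  rw [h.a_eq _ _ (by nlinarith [h.hρ, h.hρ1, sq_nonneg ρ]),
    h.z0 _ (ρ ^ 2 * v - ρ) (by nlinarith [sq_nonneg ρ])]
  unfold aa; ring

theorem GM.c_t0 (h : GM ρ p1 p2 m) (u v : ℝ) (hu : 0 ≤ u) :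
    cc ρ m (ρ ^ 2 * u) (ρ ^ 2 * v) = p2 ^ 2 * aa ρ m u v + p1 * p2 * cc ρ m u v := by
  rw [h.c_eq _ _ (by positivity)]
  unfold aa cc; ring

theorem GM.c_t2 (h : GM ρ p1 p2 m) (u v : ℝ) (hu : 0 ≤ u) :
    cc ρ m (ρ ^ 2 * u + ρ) (ρ ^ 2 * v + ρ) = p2 ^ 2 * cc ρ m u v := by
  have hr := h.hρ
  have hl := h.sq_lt
  have hs := h.sq
  rw [h.c_eq _ _ (by positivity), h.z1 (ρ ^ 2 * u + ρ + ρ) _ (by nlinarith [sq_nonneg ρ])]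
  unfold cc; ring

theorem GM.a_t2 (h : GM ρ p1 p2 m) (u v : ℝ) (hv : v ≤ 1) :
    aa ρ m (ρ ^ 2 * u + ρ) (ρ ^ 2 * v + ρ) = p1 ^ 2 * cc ρ m u v + p1 * p2 * aa ρ m u v := by
  have hs := h.sq
  rw [h.a_eq _ _ (by nlinarith [sq_nonneg ρ])]
  unfold aa cc
  simp only [add_sub_cancel_right]
  ring

theorem GM.a_t1 (h : GM ρ p1 p2 m) (u v : ℝ) (hv : v ≤ 1) :
    aa ρ m (ρ ^ 3 * u + ρ ^ 2) (ρ ^ 3 * v + ρ ^ 2)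
      = p1 ^ 2 * (p2 * aa ρ m u v + p1 * cc ρ m u v) := by
  have hs := h.sq
  have hr := h.hρ
  have h3 : ρ ^ 3 = ρ - ρ ^ 2 := by linear_combination ρ * hs
  have h3' : 0 < ρ ^ 3 := by positivity
  rw [h.a_eq _ _ (by nlinarith [h.hρ1]), h.z0 _ (ρ ^ 3 * v + ρ ^ 2 - ρ) (by nlinarith), h.t1]
  ring

theorem GM.c_t1 (h : GM ρ p1 p2 m) (u v : ℝ) (hu : 0 ≤ u) :
    cc ρ m (ρ ^ 3 * u + ρ ^ 2) (ρ ^ 3 * v + ρ ^ 2)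
      = p2 ^ 2 * (p2 * aa ρ m u v + p1 * cc ρ m u v) := by
  have hs := h.sq
  have hr := h.hρ
  rw [h.c_eq _ _ (by positivity), h.z1 (ρ ^ 3 * u + ρ ^ 2 + ρ) _
    (by have : 0 ≤ ρ ^ 3 * u := by positivity
        linarith), h.t1]
  ring

/-- full support -/
theorem GM.full_aux (h : GM ρ p1 p2 m) (n : ℕ) : ∀ x, 0 ≤ x → x ≤ 1 →
    ∃ u v, 0 ≤ u ∧ v ≤ 1 ∧ u ≤ x ∧ x ≤ v ∧ v - u = ρ ^ n ∧ (p1 * p2) ^ n ≤ m u v := by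
  have hr := h.hρ
  have hs := h.sq
  have q1 := h.hp1
  have q2 := h.hp2
  have q := h.hp
  induction n with
  | zero => exact fun x h0 h1 => ⟨0, 1, le_refl _, le_refl _, h0, h1, by simp, by simp [h.one]⟩
  | succ n ih =>
    intro x h0 h1
    have hpos : 0 ≤ (p1 * p2) ^ n := by positivity
    have hlr : ρ * (1 / ρ) = 1 := by field_simp
    by_cases hx : x ≤ ρ
    · obtain ⟨u, v, hu, hv, hux, hxv, huv, hm⟩ := ih (x / ρ) (by positivity)
        (by rw [div_le_one hr]; exact hx)
      rw [le_div_iff₀ hr] at hux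
      rw [div_le_iff₀ hr] at hxv
      refine ⟨ρ * u, ρ * v, by positivity, by nlinarith [h.hρ1], by linarith, by linarith,
        by rw [pow_succ, ← huv]; ring, ?_⟩
      rw [h.ss, pow_succ]
      have e1 := h.nn (u - ρ) (v - ρ)
      have : (p1 * p2) ^ n * (p1 * p2) ≤ p1 * m u v := by
        have : p1 * p2 * (p1 * p2) ^ n ≤ p1 * (p1 * p2) ^ n :=
          mul_le_mul_of_nonneg_right (by nlinarith) hpos
        nlinarith
      nlinarith
    · push Not at hx
      obtain ⟨u, v, hu, hv, hux, hxv, huv, hm⟩ := ih ((x - (1 - ρ)) / ρ)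
        (by have := h.sq_lt; apply div_nonneg <;> linarith)
        (by rw [div_le_one hr]; linarith)
      rw [le_div_iff₀ hr] at hux
      rw [div_le_iff₀ hr] at hxv
      refine ⟨ρ * u + (1 - ρ), ρ * v + (1 - ρ), by have := mul_nonneg hr.le hu; linarith [h.hρ1],
        by nlinarith [h.hρ1], by linarith, by linarith,
        by rw [pow_succ, ← huv]; ring, ?_⟩
      rw [h.eval _ _ (u + ρ) (v + ρ) u v (by linear_combination -hs) (by linear_combination -hs)
        (by ring) (by ring), pow_succ]
      have e1 := h.nn (u + ρ) (v + ρ)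
      have : (p1 * p2) ^ n * (p1 * p2) ≤ p2 * m u v := by
        have : p1 * p2 * (p1 * p2) ^ n ≤ p2 * (p1 * p2) ^ n :=
          mul_le_mul_of_nonneg_right (by nlinarith) hpos
        nlinarith
      nlinarith

theorem GM.full (h : GM ρ p1 p2 m) (δ : ℝ) (hδ : 0 < δ) : ∃ κ > 0, ∀ u v, 0 ≤ u → v ≤ 1 →
    δ ≤ v - u → κ ≤ m u v ∧ κ ≤ aa ρ m u v ∧ κ ≤ cc ρ m u v := by
  have q1 := h.hp1
  have q2 := h.hp2
  have q := h.hp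
  obtain ⟨n, hn⟩ := exists_pow_lt_of_lt_one (show 0 < δ / 2 by positivity) h.hρ1
  have key : ∀ u v, 0 ≤ u → v ≤ 1 → δ ≤ v - u → (p1 * p2) ^ n ≤ m u v := by
    intro u v hu hv huv
    obtain ⟨s, t, hs, ht, h1, h2, h3, h4⟩ := h.full_aux n ((u + v) / 2) (by linarith) (by linarith)
    exact h4.trans (h.mono _ _ _ _ (by linarith) (by linarith))
  have hk : 0 < (p1 * p2) ^ n := by positivity
  refine ⟨p1 ^ 2 * p2 ^ 2 * (p1 * p2) ^ n, by positivity, fun u v hu hv huv => ?_⟩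
  have hm := key u v hu hv huv
  have l1 : p1 ^ 2 ≤ 1 := by nlinarith
  have l2 : p2 ^ 2 ≤ 1 := by nlinarith
  have l3 : p1 ^ 2 * p2 ^ 2 ≤ p1 ^ 2 := by nlinarith [sq_nonneg p1]
  have l4 : p1 ^ 2 * p2 ^ 2 ≤ p2 ^ 2 := by nlinarith [sq_nonneg p2]
  refine ⟨?_, ?_, ?_⟩
  · nlinarith
  · rw [h.a_eq _ _ hv]
    have := mul_nonneg (mul_nonneg q1.le q2.le) (h.nn (u - ρ) (v - ρ))
    have : p1 ^ 2 * p2 ^ 2 * (p1 * p2) ^ n ≤ p1 ^ 2 * m u v :=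
      mul_le_mul l3 hm hk.le (by positivity)
    linarith
  · rw [h.c_eq _ _ hu]
    have := mul_nonneg (mul_nonneg q1.le q2.le) (h.nn (u + ρ) (v + ρ))
    have : p1 ^ 2 * p2 ^ 2 * (p1 * p2) ^ n ≤ p2 ^ 2 * m u v :=
      mul_le_mul l4 hm hk.le (by positivity)
    linarith

theorem GM.pow_unit (h : GM ρ p1 p2 m) (k : ℕ) (u : ℝ) (h0 : 0 ≤ u) (h1 : u ≤ 1) :
    0 ≤ (ρ ^ 2) ^ k * u ∧ (ρ ^ 2) ^ k * u ≤ 1 := by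
  have hr := h.hρ
  have : (ρ ^ 2) ^ k ≤ 1 := pow_le_one₀ (by positivity) (by nlinarith [h.hρ1])
  have h2 : 0 ≤ (ρ ^ 2) ^ k := by positivity
  constructor
  · positivity
  · nlinarith

theorem GM.iter0 (h : GM ρ p1 p2 m) (u v : ℝ) (hu : 0 ≤ u) (hu1 : u ≤ 1) (hv : 0 ≤ v)
    (hv1 : v ≤ 1) (k : ℕ) :
    aa ρ m ((ρ ^ 2) ^ (k + 1) * u) ((ρ ^ 2) ^ (k + 1) * v)
      = p1 ^ 2 * aa ρ m ((ρ ^ 2) ^ k * u) ((ρ ^ 2) ^ k * v) ∧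
    cc ρ m ((ρ ^ 2) ^ (k + 1) * u) ((ρ ^ 2) ^ (k + 1) * v)
      = p2 ^ 2 * aa ρ m ((ρ ^ 2) ^ k * u) ((ρ ^ 2) ^ k * v)
        + p1 * p2 * cc ρ m ((ρ ^ 2) ^ k * u) ((ρ ^ 2) ^ k * v) := by
  obtain ⟨a1, a2⟩ := h.pow_unit k u hu hu1
  obtain ⟨b1, b2⟩ := h.pow_unit k v hv hv1
  rw [pow_succ' (ρ ^ 2) k, mul_assoc, mul_assoc]
  exact ⟨h.a_t0 _ _ b2, h.c_t0 _ _ a1⟩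

theorem GM.iter2 (h : GM ρ p1 p2 m) (u v : ℝ) (hu : 0 ≤ u) (hu1 : u ≤ 1) (hv : 0 ≤ v)
    (hv1 : v ≤ 1) (k : ℕ) :
    aa ρ m (1 - (ρ ^ 2) ^ (k + 1) * (1 - u)) (1 - (ρ ^ 2) ^ (k + 1) * (1 - v))
      = p1 ^ 2 * cc ρ m (1 - (ρ ^ 2) ^ k * (1 - u)) (1 - (ρ ^ 2) ^ k * (1 - v))
       + p1 * p2 * aa ρ m (1 - (ρ ^ 2) ^ k * (1 - u)) (1 - (ρ ^ 2) ^ k * (1 - v)) ∧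
    cc ρ m (1 - (ρ ^ 2) ^ (k + 1) * (1 - u)) (1 - (ρ ^ 2) ^ (k + 1) * (1 - v))
      = p2 ^ 2 * cc ρ m (1 - (ρ ^ 2) ^ k * (1 - u)) (1 - (ρ ^ 2) ^ k * (1 - v)) := by
  obtain ⟨a1, a2⟩ := h.pow_unit k (1 - u) (by linarith) (by linarith)
  obtain ⟨b1, b2⟩ := h.pow_unit k (1 - v) (by linarith) (by linarith)
  have e : ∀ w : ℝ, 1 - (ρ ^ 2) ^ (k + 1) * (1 - w) = ρ ^ 2 * (1 - (ρ ^ 2) ^ k * (1 - w)) + ρ := by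
    intro w; rw [pow_succ' (ρ ^ 2) k]; linear_combination - h.sq
  rw [e, e]
  exact ⟨h.a_t2 _ _ (by linarith), h.c_t2 _ _ (by linarith)⟩

theorem seq_bound (P q : ℝ) (hq : 0 < q) (hP : q < P) (x y : ℕ → ℝ) (hx0 : 0 ≤ x 0)
    (hy0 : 0 < y 0) (hx : ∀ n, x (n + 1) = P * q * x n + P ^ 2 * y n)
    (hy : ∀ n, y (n + 1) = q ^ 2 * y n) :
    ∃ K, ∀ n, x n ≤ K * (P * q) ^ n ∧ y n ≤ K * (P * q) ^ n := by
  set l : ℝ := P ^ 2 / (q * (P - q)) with hl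
  have hd : 0 < q * (P - q) := mul_pos hq (by linarith)
  have hl0 : 0 < l := by have : 0 < P := by linarith
                         positivity
  have hlq : l * (q * (P - q)) = P ^ 2 := by rw [hl]; exact div_mul_cancel₀ _ hd.ne'
  have hyp : ∀ n, 0 < y n := by
    intro n; induction n with
    | zero => exact hy0
    | succ n ih => rw [hy]; positivity
  have hPp : 0 < P := by linarith
  have hxp : ∀ n, 0 ≤ x n := by
    intro n; induction n with
    | zero => exact hx0
    | succ n ih => rw [hx]; have := hyp n; positivity
  have key : ∀ n, x n + l * y n ≤ (x 0 + l * y 0) * (P * q) ^ n := by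
    intro n; induction n with
    | zero => simp
    | succ n ih =>
      have : x (n + 1) + l * y (n + 1) = (P * q) * (x n + l * y n) := by
        rw [hx, hy]; linear_combination -(y n) * hlq
      rw [this, pow_succ]
      have : 0 < P * q := by positivity
      nlinarith
  refine ⟨(x 0 + l * y 0) * (1 + 1 / l), fun n => ?_⟩
  have k := key n
  have a1 := hxp n
  have a2 := mul_pos hl0 (hyp n)
  have a3 : 0 < 1 / l := by positivity
  have a4 : y n ≤ (1 / l) * ((x 0 + l * y 0) * (P * q) ^ n) := by
    rw [one_div, inv_mul_eq_div, le_div_iff₀ hl0]; linarith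
  constructor
  · have : 0 ≤ (1 / l) * ((x 0 + l * y 0) * (P * q) ^ n) := by linarith [hyp n]
    linarith
  · linarith

theorem GM.nonneg_ac (h : GM ρ p1 p2 m) (u v : ℝ) : 0 ≤ aa ρ m u v ∧ 0 ≤ cc ρ m u v :=
  ⟨h.nn _ _, h.nn _ _⟩

theorem pow_contra (P q A B : ℝ) (hq : 0 < q) (hP : q < P) (hA : 0 < A)
    (hh : ∀ n : ℕ, A * P ^ (2 * n) ≤ B * (P * q) ^ n) : False := by
  have hP0 : 0 < P := by linarith
  obtain ⟨n, hn⟩ := pow_unbounded_of_one_lt (B / A) (show 1 < P / q by rwa [one_lt_div hq])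
  have := hh n
  rw [div_lt_iff₀ hA, div_pow, div_mul_eq_mul_div, lt_div_iff₀ (by positivity)] at hn
  rw [mul_pow, two_mul, pow_add] at this
  have hp : 0 < P ^ n := by positivity
  nlinarith

theorem GM.not_doubling (h : GM ρ p1 p2 m) (C : ℝ) (hC0 : 0 ≤ C)
    (hC : ∀ x r, 0 ≤ x → x ≤ 1 → 0 < r → m (x - 2 * r) (x + 2 * r) ≤ C * m (x - r) (x + r)) :
    p1 = p2 := by
  have hr := h.hρ
  have hr1 := h.hρ1
  have hs := h.sq
  have q1 := h.hp1
  have q2 := h.hp2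
  have q := h.hp
  have hl := h.sq_lt
  set L : ℕ → ℝ := fun n => aa ρ m (1 - (ρ ^ 2) ^ n * (1 - 0)) (1 - (ρ ^ 2) ^ n * (1 - 1)) with hL
  set Lc : ℕ → ℝ := fun n => cc ρ m (1 - (ρ ^ 2) ^ n * (1 - 0)) (1 - (ρ ^ 2) ^ n * (1 - 1)) with hLc
  set Ra : ℕ → ℝ := fun n => aa ρ m ((ρ ^ 2) ^ n * 0) ((ρ ^ 2) ^ n * 1) with hRa
  set Rc : ℕ → ℝ := fun n => cc ρ m ((ρ ^ 2) ^ n * 0) ((ρ ^ 2) ^ n * 1) with hRc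
  have iL : ∀ n, L (n + 1) = p1 ^ 2 * Lc n + p1 * p2 * L n ∧ Lc (n + 1) = p2 ^ 2 * Lc n :=
    fun n => h.iter2 0 1 (by norm_num) (by norm_num) (by norm_num) (by norm_num) n
  have iR : ∀ n, Ra (n + 1) = p1 ^ 2 * Ra n ∧ Rc (n + 1) = p2 ^ 2 * Ra n + p1 * p2 * Rc n :=
    fun n => h.iter0 0 1 (by norm_num) (by norm_num) (by norm_num) (by norm_num) n
  obtain ⟨κ, hκ, hf⟩ := h.full 1 one_pos
  obtain ⟨-, ha0, hc0⟩ := hf 0 1 (le_refl _) (le_refl _) (by norm_num)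
  have L0 : 0 < L 0 := by simp only [hL]; norm_num; linarith
  have Lc0 : 0 < Lc 0 := by simp only [hLc]; norm_num; linarith
  have Ra0 : 0 < Ra 0 := by simp only [hRa]; norm_num; linarith
  have Rc0 : 0 < Rc 0 := by simp only [hRc]; norm_num; linarith
  have eLc : ∀ n, Lc n = Lc 0 * p2 ^ (2 * n) := by
    intro n; induction n with
    | zero => simp
    | succ n ih => rw [(iL n).2, ih, mul_add, pow_add]; ring
  have eRa : ∀ n, Ra n = Ra 0 * p1 ^ (2 * n) := by
    intro n; induction n with
    | zero => simp
    | succ n ih => rw [(iR n).1, ih, mul_add, pow_add]; ring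
  have C8 : ∀ x r, 0 ≤ x → x ≤ 1 → 0 < r → ∀ u v, x - 8 * r ≤ u → v ≤ x + 8 * r →
      m u v ≤ C ^ 3 * m (x - r) (x + r) := by
    intro x r h0 h1 hr u v hu hv
    have e1 := hC x r h0 h1 hr
    have e2 := hC x (2 * r) h0 h1 (by positivity)
    have e3 := hC x (2 * (2 * r)) h0 h1 (by positivity)
    have e4 := h.mono u v (x - 2 * (2 * (2 * r))) (x + 2 * (2 * (2 * r))) (by linarith) (by linarith)
    have e5 := mul_le_mul_of_nonneg_left e1 hC0
    have e6 := mul_le_mul_of_nonneg_left (e2.trans e5) hC0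
    calc m u v ≤ _ := e4.trans (e3.trans e6)
      _ = _ := by ring
  have mL : ∀ n, L n = m (ρ ^ 2 - ρ ^ 2 * (ρ ^ 2) ^ n) (ρ ^ 2) := by
    intro n; simp only [hL, aa]; congr 1 <;> ring
  have mR : ∀ n, p2 * Ra n + p1 * Rc n = m (ρ ^ 2) (ρ ^ 2 + ρ ^ 3 * (ρ ^ 2) ^ n) := by
    intro n; simp only [hRa, hRc]; rw [← h.t1]; congr 1 <;> ring
  have RL : ∀ n, p2 * Ra n + p1 * Rc n ≤ C ^ 3 * L n := by
    intro n
    obtain ⟨b1, b2⟩ := h.pow_unit n 1 zero_le_one le_rfl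
    rw [mul_one] at b1 b2
    have hE : 0 < (ρ ^ 2) ^ n := by positivity
    have hE2 : ρ ^ 2 * (ρ ^ 2) ^ n ≤ ρ ^ 2 := by nlinarith [sq_nonneg ρ]
    have hE4 : 0 < ρ ^ 2 * (ρ ^ 2) ^ n := by positivity
    have hE3 : ρ ^ 3 * (ρ ^ 2) ^ n ≤ ρ ^ 2 * (ρ ^ 2) ^ n := by nlinarith
    rw [mL, mR]
    have := C8 (ρ ^ 2 - ρ ^ 2 * (ρ ^ 2) ^ n / 2) (ρ ^ 2 * (ρ ^ 2) ^ n / 2) (by linarith)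
      (by linarith) (by positivity) (ρ ^ 2) (ρ ^ 2 + ρ ^ 3 * (ρ ^ 2) ^ n) (by linarith) (by linarith)
    convert this using 3 <;> ring
  have LR : ∀ n, L n ≤ C ^ 3 * (p2 * Ra n + p1 * Rc n) := by
    intro n
    obtain ⟨b1, b2⟩ := h.pow_unit n 1 zero_le_one le_rfl
    rw [mul_one] at b1 b2
    have hE : 0 < (ρ ^ 2) ^ n := by positivity
    have hr2 : 1 / 2 < ρ := by nlinarith
    have hE4 : 0 < ρ ^ 2 * (ρ ^ 2) ^ n := by positivity
    have hE5 : 0 < ρ ^ 3 * (ρ ^ 2) ^ n := by positivity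
    have hE3 : ρ ^ 2 * (ρ ^ 2) ^ n ≤ 2 * (ρ ^ 3 * (ρ ^ 2) ^ n) := by nlinarith
    have hE6 : ρ ^ 3 * (ρ ^ 2) ^ n ≤ ρ := by
      have : ρ ^ 3 ≤ ρ := by nlinarith
      have : ρ ^ 3 * (ρ ^ 2) ^ n ≤ ρ ^ 3 := mul_le_of_le_one_right (by positivity) b2
      linarith
    rw [mL, mR]
    have := C8 (ρ ^ 2 + ρ ^ 3 * (ρ ^ 2) ^ n / 2) (ρ ^ 3 * (ρ ^ 2) ^ n / 2) (by positivity)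
      (by linarith) (by positivity) (ρ ^ 2 - ρ ^ 2 * (ρ ^ 2) ^ n) (ρ ^ 2) (by linarith) (by linarith)
    convert this using 3 <;> ring
  have hC3 : 0 ≤ C ^ 3 := by positivity
  rcases lt_trichotomy p1 p2 with hlt | heq | hgt
  · exfalso
    obtain ⟨K, hK⟩ := seq_bound p2 p1 q1 hlt Rc Ra Rc0.le Ra0
      (fun n => by rw [(iR n).2]; ring) (fun n => (iR n).1)
    refine pow_contra p2 p1 (p1 ^ 2 * Lc 0) (C ^ 3 * K * (p2 * p1)) q1 hlt (by positivity) fun n => ?_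
    have e1 := LR (n + 1)
    have e2 := (iL n).1
    have e3 : 0 ≤ L n := h.nn _ _
    have e4 := hK (n + 1)
    have e5 : p2 * Ra (n + 1) + p1 * Rc (n + 1) ≤ K * (p2 * p1) ^ (n + 1) := by
      obtain ⟨f1, f2⟩ := e4
      calc _ ≤ p2 * (K * (p2 * p1) ^ (n + 1)) + p1 * (K * (p2 * p1) ^ (n + 1)) := by gcongr
        _ = _ := by rw [← add_mul, add_comm p2, q, one_mul]
    have e6 := mul_le_mul_of_nonneg_left e5 hC3
    have e7 : 0 ≤ p1 * p2 * L n := by positivity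
    rw [eLc n] at e2
    rw [pow_succ (p2 * p1)] at e6
    linarith
  · exact heq
  · exfalso
    obtain ⟨K, hK⟩ := seq_bound p1 p2 q2 hgt L Lc L0.le Lc0
      (fun n => by rw [(iL n).1]; ring) (fun n => (iL n).2)
    refine pow_contra p1 p2 (p2 * Ra 0) (C ^ 3 * K) q2 hgt (by positivity) fun n => ?_
    have e1 := RL n
    have e2 : 0 ≤ p1 * Rc n := mul_nonneg q1.le (h.nn _ _)
    have e4 := mul_le_mul_of_nonneg_left (hK n).1 hC3
    rw [eRa n] at e1
    linarith

end

/-- componentwise comparison of `[x, y]` by `[u, v]`. -/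
def Cmp (ρ : ℝ) (m : ℝ → ℝ → ℝ) (C u v x y : ℝ) : Prop :=
  m x y ≤ C * m u v ∧ aa ρ m x y ≤ C * aa ρ m u v ∧ cc ρ m x y ≤ C * cc ρ m u v

/-- lower bounds -/
def LBd (ρ : ℝ) (m : ℝ → ℝ → ℝ) (C u v : ℝ) : Prop :=
  C ≤ m u v ∧ C ≤ aa ρ m u v ∧ C ≤ cc ρ m u v

/-- upper bounds -/
def UBd (ρ : ℝ) (m : ℝ → ℝ → ℝ) (C u v : ℝ) : Prop :=
  m u v ≤ C ∧ aa ρ m u v ≤ C ∧ cc ρ m u v ≤ C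

section
variable {ρ : ℝ} {m : ℝ → ℝ → ℝ}

theorem GM.iter0h (h : GM ρ (1/2) (1/2) m) (u v : ℝ) (hu : 0 ≤ u) (hu1 : u ≤ 1) (hv : 0 ≤ v)
    (hv1 : v ≤ 1) (k : ℕ) :
    aa ρ m ((ρ ^ 2) ^ k * u) ((ρ ^ 2) ^ k * v) = (1 / 4) ^ k * aa ρ m u v ∧
    cc ρ m ((ρ ^ 2) ^ k * u) ((ρ ^ 2) ^ k * v) = (1 / 4) ^ k * (cc ρ m u v + k * aa ρ m u v) := by
  induction k with
  | zero => simp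
  | succ k ih =>
    obtain ⟨e1, e2⟩ := h.iter0 u v hu hu1 hv hv1 k
    rw [e1, e2, ih.1, ih.2, pow_succ]
    push_cast
    constructor <;> ring

theorem GM.iter2h (h : GM ρ (1/2) (1/2) m) (u v : ℝ) (hu : 0 ≤ u) (hu1 : u ≤ 1) (hv : 0 ≤ v)
    (hv1 : v ≤ 1) (k : ℕ) :
    aa ρ m (1 - (ρ ^ 2) ^ k * (1 - u)) (1 - (ρ ^ 2) ^ k * (1 - v))
      = (1 / 4) ^ k * (aa ρ m u v + k * cc ρ m u v) ∧
    cc ρ m (1 - (ρ ^ 2) ^ k * (1 - u)) (1 - (ρ ^ 2) ^ k * (1 - v)) = (1 / 4) ^ k * cc ρ m u v := by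
  induction k with
  | zero => simp
  | succ k ih =>
    obtain ⟨e1, e2⟩ := h.iter2 u v hu hu1 hv hv1 k
    rw [e1, e2, ih.1, ih.2, pow_succ]
    push_cast
    constructor <;> ring

theorem GM.left_eq (h : GM ρ (1/2) (1/2) m) (u v : ℝ) (hu : 0 ≤ u) (hu1 : u ≤ 1) (hv : 0 ≤ v)
    (hv1 : v ≤ 1) (k : ℕ) (x y a c : ℝ) (hx : x = ρ ^ 2 * (1 - (ρ ^ 2) ^ k * (1 - u)))
    (hy : y = ρ ^ 2 * (1 - (ρ ^ 2) ^ k * (1 - v))) (ha : a = aa ρ m u v) (hc : c = cc ρ m u v) :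
    m x y = (1 / 4) ^ k * (a + k * c) ∧ aa ρ m x y = (1 / 4) ^ k * ((a + k * c) / 4) ∧
    cc ρ m x y = (1 / 4) ^ k * ((a + (k + 1) * c) / 4) := by
  obtain ⟨e1, e2⟩ := h.iter2h u v hu hu1 hv hv1 k
  obtain ⟨a1, a2⟩ := h.pow_unit k (1 - u) (by linarith) (by linarith)
  obtain ⟨b1, b2⟩ := h.pow_unit k (1 - v) (by linarith) (by linarith)
  subst hx hy ha hc
  refine ⟨e1, ?_, ?_⟩
  · rw [h.a_t0 _ _ (by linarith), e1]; ring
  · rw [h.c_t0 _ _ (by linarith), e1, e2]; ring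

theorem GM.right_eq (h : GM ρ (1/2) (1/2) m) (u v : ℝ) (hu : 0 ≤ u) (hu1 : u ≤ 1) (hv : 0 ≤ v)
    (hv1 : v ≤ 1) (k : ℕ) (x y a c : ℝ) (hx : x = ρ ^ 3 * ((ρ ^ 2) ^ k * u) + ρ ^ 2)
    (hy : y = ρ ^ 3 * ((ρ ^ 2) ^ k * v) + ρ ^ 2) (ha : a = aa ρ m u v) (hc : c = cc ρ m u v) :
    m x y = (1 / 4) ^ k * ((c + (k + 1) * a) / 2) ∧
    aa ρ m x y = (1 / 4) ^ k * ((c + (k + 1) * a) / 8) ∧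
    cc ρ m x y = (1 / 4) ^ k * ((c + (k + 1) * a) / 8) := by
  obtain ⟨e1, e2⟩ := h.iter0h u v hu hu1 hv hv1 k
  obtain ⟨a1, a2⟩ := h.pow_unit k u (by linarith) (by linarith)
  obtain ⟨b1, b2⟩ := h.pow_unit k v (by linarith) (by linarith)
  subst hx hy ha hc
  refine ⟨?_, ?_, ?_⟩
  · rw [h.t1, e1, e2]; ring
  · rw [h.a_t1 _ _ b2, e1, e2]; ring
  · rw [h.c_t1 _ _ a1, e1, e2]; ring

theorem GM.straddle (h : GM ρ (1/2) (1/2) m) (δ : ℝ) (hδ : 0 < δ) : ∃ C, 0 ≤ C ∧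
    ∀ x u v y, 0 ≤ x → x ≤ u → v ≤ y → y ≤ 1 → x ≤ ρ ^ 2 → ρ ^ 2 ≤ y → x < y →
    y - x ≤ ρ ^ 3 → δ * (y - x) ≤ v - u → Cmp ρ m C u v x y := by
  have hr := h.hρ
  have hr1 := h.hρ1
  obtain ⟨κ, hκ, hf⟩ := h.full (δ / 2 * ρ ^ 3) (by positivity)
  refine ⟨16 / κ, by positivity, ?_⟩
  intro x u v y hx hxu hvy hy hxρ hyρ hxy hlen hδl
  have hr3 : 0 < ρ ^ 3 := by positivity
  have hr2 : 0 < ρ ^ 2 := by positivity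
  obtain ⟨k, hk1, hk2⟩ := exists_nat_pow_near_of_lt_one (x := (y - x) / ρ ^ 3) (y := ρ ^ 2)
    (div_pos (by linarith) hr3) (by rw [div_le_one hr3]; exact hlen) hr2 (by nlinarith)
  rw [lt_div_iff₀ hr3] at hk1
  rw [div_le_iff₀ hr3] at hk2
  rw [pow_succ] at hk1
  set E := (ρ ^ 2) ^ k with hE
  have hE0 : 0 < E := by positivity
  have h32 : E * ρ ^ 3 ≤ E * ρ ^ 2 := by
    apply mul_le_mul_of_nonneg_left _ hE0.le; nlinarith
  set q : ℝ := (1 / 4) ^ k with hq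
  have hq0 : 0 < q := by positivity
  have hk0 : (0 : ℝ) ≤ k := Nat.cast_nonneg k
  -- upper bounds
  have upL : UBd ρ m (q * (k + 1)) x (ρ ^ 2) := by
    obtain ⟨a1, a2⟩ := h.nonneg_ac 0 1
    have a3 : aa ρ m 0 1 ≤ 1 := h.le1 _ _
    have a4 : cc ρ m 0 1 ≤ 1 := h.le1 _ _
    obtain ⟨e1, e2, e3⟩ := h.left_eq 0 1 le_rfl zero_le_one zero_le_one le_rfl k
      (ρ ^ 2 - E * ρ ^ 2) (ρ ^ 2) _ _ (by ring) (by ring) rfl rfl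
    have hxx : ρ ^ 2 - E * ρ ^ 2 ≤ x := by linarith
    have hkc : k * cc ρ m 0 1 ≤ k := mul_le_of_le_one_right hk0 a4
    refine ⟨?_, ?_, ?_⟩
    · refine (h.mono _ _ _ _ hxx le_rfl).trans (e1.le.trans ?_)
      apply mul_le_mul_of_nonneg_left _ hq0.le; linarith
    · refine (h.mono _ _ _ _ (mul_le_mul_of_nonneg_left hxx hr2.le) le_rfl).trans (e2.le.trans ?_)
      apply mul_le_mul_of_nonneg_left _ hq0.le; linarith
    · refine (h.mono _ _ _ _ (by gcongr) le_rfl).trans (e3.le.trans ?_)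
      apply mul_le_mul_of_nonneg_left _ hq0.le; linarith
  have upR : UBd ρ m (q * (k + 1)) (ρ ^ 2) y := by
    obtain ⟨a1, a2⟩ := h.nonneg_ac 0 1
    have a3 : aa ρ m 0 1 ≤ 1 := h.le1 _ _
    have a4 : cc ρ m 0 1 ≤ 1 := h.le1 _ _
    obtain ⟨e1, e2, e3⟩ := h.right_eq 0 1 le_rfl zero_le_one zero_le_one le_rfl k
      (ρ ^ 2) (ρ ^ 2 + E * ρ ^ 3) _ _ (by ring) (by ring) rfl rfl
    have hxx : y ≤ ρ ^ 2 + E * ρ ^ 3 := by linarith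
    have hkc : k * aa ρ m 0 1 ≤ k := mul_le_of_le_one_right hk0 a3
    refine ⟨?_, ?_, ?_⟩
    · refine (h.mono _ _ _ _ le_rfl hxx).trans (e1.le.trans ?_)
      apply mul_le_mul_of_nonneg_left _ hq0.le; linarith
    · refine (h.mono _ _ _ _ le_rfl (mul_le_mul_of_nonneg_left hxx hr2.le)).trans (e2.le.trans ?_)
      apply mul_le_mul_of_nonneg_left _ hq0.le; linarith
    · refine (h.mono _ _ _ _ le_rfl (by gcongr)).trans (e3.le.trans ?_)
      apply mul_le_mul_of_nonneg_left _ hq0.le; linarith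
  -- lower bound
  have low : LBd ρ m (q * (k + 1) * (κ / 8)) u v := by
    have hδ' : 0 < δ * (y - x) := mul_pos hδ (by linarith)
    by_cases hc : δ / 2 * (y - x) ≤ min v (ρ ^ 2) - u
    · set w := min v (ρ ^ 2) with hw
      have w1 : w ≤ v := min_le_left _ _
      have w2 : w ≤ ρ ^ 2 := min_le_right _ _
      have hD : 0 < E * ρ ^ 2 := by positivity
      have hD' : (0:ℝ) < ρ ^ 2 * E := by positivity
      set s := 1 - (ρ ^ 2 - u) / (E * ρ ^ 2) with hs
      set t := 1 - (ρ ^ 2 - w) / (E * ρ ^ 2) with ht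
      have hs0 : 0 ≤ s := by
        rw [hs, sub_nonneg, div_le_one hD]; linarith
      have ht1 : t ≤ 1 := by
        have : 0 ≤ (ρ ^ 2 - w) / (E * ρ ^ 2) := div_nonneg (by linarith) hD.le
        linarith
      have hst : δ / 2 * ρ ^ 3 ≤ t - s := by
        have : t - s = (w - u) / (E * ρ ^ 2) := by rw [hs, ht]; ring
        rw [this, le_div_iff₀ hD]
        refine le_trans ?_ hc
        have := mul_le_mul_of_nonneg_left hk1.le (show 0 ≤ δ / 2 by positivity)
        linarith
      have hp : 0 < δ / 2 * ρ ^ 3 := by positivity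
      obtain ⟨f0, f1, f2⟩ := hf s t hs0 ht1 hst
      obtain ⟨e1, e2, e3⟩ := h.left_eq s t hs0 (by linarith) (by linarith) ht1 k u w _ _
        (by rw [← hE, hs]; field_simp; ring) (by rw [← hE, ht]; field_simp; ring) rfl rfl
      have hkc : k * κ ≤ k * cc ρ m s t := mul_le_mul_of_nonneg_left f2 hk0
      have hkk : 0 ≤ k * κ := by positivity
      refine ⟨?_, ?_, ?_⟩
      · refine le_trans ?_ (e1.ge.trans (h.mono _ _ _ _ le_rfl w1))
        rw [mul_assoc]
        apply mul_le_mul_of_nonneg_left _ hq0.le; linarith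
      · refine le_trans ?_ (e2.ge.trans (h.mono _ _ _ _ le_rfl (mul_le_mul_of_nonneg_left w1 hr2.le)))
        rw [mul_assoc]
        apply mul_le_mul_of_nonneg_left _ hq0.le; linarith
      · refine le_trans ?_ (e3.ge.trans (h.mono _ _ _ _ le_rfl (by gcongr)))
        rw [mul_assoc]
        apply mul_le_mul_of_nonneg_left _ hq0.le; linarith
    · set w := max u (ρ ^ 2) with hw
      have w1 : u ≤ w := le_max_left _ _
      have w2 : ρ ^ 2 ≤ w := le_max_right _ _
      have hc' : δ / 2 * (y - x) ≤ v - w := by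
        push Not at hc
        rcases le_total v (ρ ^ 2) with h1 | h1
        · rw [min_eq_left h1] at hc; linarith
        · rw [min_eq_right h1] at hc
          rcases le_total u (ρ ^ 2) with h2 | h2
          · rw [hw, max_eq_right h2]; linarith
          · rw [hw, max_eq_left h2]; linarith
      have hD : 0 < E * ρ ^ 3 := by positivity
      set s := (w - ρ ^ 2) / (E * ρ ^ 3) with hs
      set t := (v - ρ ^ 2) / (E * ρ ^ 3) with ht
      have hs0 : 0 ≤ s := div_nonneg (by linarith) hD.le
      have ht1 : t ≤ 1 := by
        rw [ht, div_le_one hD]; linarith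
      have hst : δ / 2 * ρ ^ 3 ≤ t - s := by
        have : t - s = (v - w) / (E * ρ ^ 3) := by rw [hs, ht]; ring
        rw [this, le_div_iff₀ hD]
        refine le_trans ?_ hc'
        have := mul_le_mul_of_nonneg_left hk1.le (show 0 ≤ δ / 2 by positivity)
        have h3 := mul_le_mul_of_nonneg_left h32 (show 0 ≤ δ / 2 * ρ ^ 3 by positivity)
        linarith
      have hp : 0 < δ / 2 * ρ ^ 3 := by positivity
      obtain ⟨f0, f1, f2⟩ := hf s t hs0 ht1 hst
      obtain ⟨e1, e2, e3⟩ := h.right_eq s t hs0 (by linarith) (by linarith) ht1 k w v _ _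
        (by rw [← hE, hs]; field_simp; ring) (by rw [← hE, ht]; field_simp; ring) rfl rfl
      have hkc : k * κ ≤ k * aa ρ m s t := mul_le_mul_of_nonneg_left f1 hk0
      have hkk : 0 ≤ k * κ := by positivity
      refine ⟨?_, ?_, ?_⟩
      · refine le_trans ?_ (e1.ge.trans (h.mono _ _ _ _ w1 le_rfl))
        rw [mul_assoc]
        apply mul_le_mul_of_nonneg_left _ hq0.le; linarith
      · refine le_trans ?_ (e2.ge.trans (h.mono _ _ _ _ (mul_le_mul_of_nonneg_left w1 hr2.le) le_rfl))
        rw [mul_assoc]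
        apply mul_le_mul_of_nonneg_left _ hq0.le; linarith
      · refine le_trans ?_ (e3.ge.trans (h.mono _ _ _ _ (by gcongr) le_rfl))
        rw [mul_assoc]
        apply mul_le_mul_of_nonneg_left _ hq0.le; linarith
  have fin : ∀ A B, A ≤ q * (k + 1) + q * (k + 1) → q * (k + 1) * (κ / 8) ≤ B → A ≤ 16 / κ * B := by
    intro A B hA hB
    have := mul_le_mul_of_nonneg_left hB (show 0 ≤ 16 / κ by positivity)
    have e : 16 / κ * (q * (k + 1) * (κ / 8)) = q * (k + 1) + q * (k + 1) := by field_simp; ring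
    linarith
  obtain ⟨u1, u2, u3⟩ := upL
  obtain ⟨v1, v2, v3⟩ := upR
  obtain ⟨l1, l2, l3⟩ := low
  exact ⟨fin _ _ ((h.sub _ _ _).trans (add_le_add u1 v1)) l1,
    fin _ _ ((h.sub _ _ _).trans (add_le_add u2 v2)) l2,
    fin _ _ ((h.sub _ _ _).trans (add_le_add u3 v3)) l3⟩

theorem GM.straddle' (h : GM ρ (1/2) (1/2) m) (δ : ℝ) (hδ : 0 < δ) : ∃ C, 0 ≤ C ∧
    ∀ x u v y, 0 ≤ x → x ≤ u → v ≤ y → y ≤ 1 → x ≤ ρ → ρ ≤ y → x < y →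
    y - x ≤ ρ ^ 3 → δ * (y - x) ≤ v - u → Cmp ρ m C u v x y := by
  obtain ⟨C, hC0, hC⟩ := h.refl.straddle δ hδ
  have hs := h.sq
  refine ⟨C, hC0, ?_⟩
  intro x u v y h1 h2 h3 h4 h5 h6 h7 h8 h9
  obtain ⟨e1, e2, e3⟩ := hC (1 - y) (1 - v) (1 - u) (1 - x) (by linarith) (by linarith)
    (by linarith) (by linarith) (by linarith) (by linarith) (by linarith) (by linarith)
    (by linarith)
  have t1 : ∀ z : ℝ, 1 - ρ ^ 2 * (1 - z) = ρ ^ 2 * z + ρ := fun z => by linear_combination -hs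
  have t2 : ∀ z : ℝ, 1 - (ρ ^ 2 * (1 - z) + ρ) = ρ ^ 2 * z := fun z => by linear_combination -hs
  simp only [aa, cc, sub_sub_cancel, t1, t2] at e1 e2 e3
  exact ⟨e1, e3, e2⟩

theorem GM.cmp_mono (h : GM ρ (1/2) (1/2) m) {C C' u v x y : ℝ} (hC : C ≤ C')
    (hh : Cmp ρ m C u v x y) : Cmp ρ m C' u v x y := by
  obtain ⟨h1, h2, h3⟩ := hh
  obtain ⟨a1, a2⟩ := h.nonneg_ac u v
  exact ⟨h1.trans (mul_le_mul_of_nonneg_right hC (h.nn _ _)),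
    h2.trans (mul_le_mul_of_nonneg_right hC a1), h3.trans (mul_le_mul_of_nonneg_right hC a2)⟩

theorem GM.compare (h : GM ρ (1/2) (1/2) m) (δ : ℝ) (hδ : 0 < δ) : ∃ C, 0 ≤ C ∧
    ∀ n : ℕ, ∀ x u v y, 0 ≤ x → x ≤ u → u ≤ v → v ≤ y → y ≤ 1 → (ρ ^ 2) ^ n ≤ y - x →
    δ * (y - x) ≤ v - u → Cmp ρ m C u v x y := by
  have hr := h.hρ
  have hr1 := h.hρ1
  have hs := h.sq
  have hr3 : 0 < ρ ^ 3 := by positivity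
  have hr2 : 0 < ρ ^ 2 := by positivity
  have h3 : ρ ^ 3 = ρ - ρ ^ 2 := by linear_combination ρ * hs
  have h32 : ρ ^ 3 ≤ ρ ^ 2 := by nlinarith
  obtain ⟨C1, hC1, hs1⟩ := h.straddle δ hδ
  obtain ⟨C2, hC2, hs2⟩ := h.straddle' δ hδ
  obtain ⟨κ, hκ, hf⟩ := h.full (δ * ρ ^ 3) (by positivity)
  have hκ' : 0 < 1 / κ := by positivity
  refine ⟨C1 + C2 + 1 / κ, by positivity, ?_⟩
  have big : ∀ x u v y, 0 ≤ x → x ≤ u → v ≤ y → y ≤ 1 → ρ ^ 3 ≤ y - x →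
      δ * (y - x) ≤ v - u → Cmp ρ m (C1 + C2 + 1 / κ) u v x y := by
    intro x u v y h0 h1 h2 h3 h4 h5
    have h6 := mul_le_mul_of_nonneg_left h4 hδ.le
    obtain ⟨f1, f2, f3⟩ := hf u v (by linarith) (by linarith) (by linarith)
    refine h.cmp_mono (show 1 / κ ≤ _ by linarith) ?_
    have fin : ∀ A B, A ≤ 1 → κ ≤ B → A ≤ 1 / κ * B := by
      intro A B hA hB
      rw [one_div, inv_mul_eq_div, le_div_iff₀ hκ]; nlinarith
    exact ⟨fin _ _ (h.le1 _ _) f1, fin _ _ (h.le1 _ _) f2, fin _ _ (h.le1 _ _) f3⟩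
  have hC0 : 0 ≤ C1 + C2 + 1 / κ := by positivity
  intro n
  induction n with
  | zero =>
    intro x u v y h0 h1 huv h2 h3 h4 h5
    simp only [pow_zero] at h4
    exact big x u v y h0 h1 h2 h3 (by nlinarith) h5
  | succ n ih =>
    intro x u v y h0 h1 huv h2 hy1 h4 h5
    have hn : 0 < (ρ ^ 2) ^ n := by positivity
    rw [pow_succ] at h4
    have hn' : 0 < (ρ ^ 2) ^ n * ρ ^ 2 := by positivity
    by_cases hb : ρ ^ 3 ≤ y - x
    · exact big x u v y h0 h1 h2 hy1 hb h5
    push Not at hb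
    -- pulling back under a map `z ↦ l z + b`
    have pull : ∀ l b, 0 < l → l ≤ ρ ^ 2 → b ≤ x → y ≤ l + b →
        ∃ x' u' v' y', x = l * x' + b ∧ u = l * u' + b ∧ v = l * v' + b ∧ y = l * y' + b ∧
          0 ≤ x' ∧ x' ≤ 1 ∧ 0 ≤ u' ∧ u' ≤ 1 ∧ 0 ≤ v' ∧ v' ≤ 1 ∧ 0 ≤ y' ∧ y' ≤ 1 ∧
          Cmp ρ m (C1 + C2 + 1 / κ) u' v' x' y' := by
      intro l b hl hl2 hbx hyl
      have i0 : ∀ z, b ≤ z → 0 ≤ (z - b) / l := fun z hz => div_nonneg (by linarith) hl.le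
      have i1 : ∀ z, z ≤ y → (z - b) / l ≤ 1 := fun z hz => by rw [div_le_one hl]; linarith
      have i2 : ∀ z, z = l * ((z - b) / l) + b := fun z => by field_simp; ring
      refine ⟨(x - b) / l, (u - b) / l, (v - b) / l, (y - b) / l, i2 x, i2 u, i2 v, i2 y,
        i0 x hbx, i1 x (by linarith), i0 u (by linarith), i1 u (by linarith), i0 v (by linarith),
        i1 v (by linarith), i0 y (by linarith), i1 y (by linarith), ?_⟩
      apply ih
      · exact i0 x hbx
      · gcongr
      · gcongr
      · gcongr
      · exact i1 y le_rfl
      · rw [← sub_div, le_div_iff₀ hl]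
        nlinarith
      · rw [← sub_div, ← sub_div, ← mul_div_assoc]
        gcongr
        linarith
    rcases le_total y (ρ ^ 2) with c1 | c1
    · obtain ⟨x', u', v', y', ex, eu, ev, ey, x0, x1, u0, u1, v0, v1, y0, y1, d1, d2, d3⟩ :=
        pull (ρ ^ 2) 0 hr2 le_rfl h0 (by linarith)
      rw [add_zero] at ex eu ev ey
      subst ex eu ev ey
      refine ⟨d2, ?_, ?_⟩
      · rw [h.a_t0 _ _ y1, h.a_t0 _ _ v1]; linarith
      · rw [h.c_t0 _ _ x0, h.c_t0 _ _ u0]; linarith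
    rcases le_total x (ρ ^ 2) with c2 | c2
    · exact h.cmp_mono (by linarith) (hs1 x u v y h0 h1 h2 hy1 c2 c1 (by linarith) hb.le h5)
    rcases le_total y ρ with c3 | c3
    · obtain ⟨x', u', v', y', ex, eu, ev, ey, x0, x1, u0, u1, v0, v1, y0, y1, d1, d2, d3⟩ :=
        pull (ρ ^ 3) (ρ ^ 2) hr3 h32 c2 (by linarith)
      subst ex eu ev ey
      refine ⟨?_, ?_, ?_⟩
      · rw [h.t1, h.t1]; linarith
      · rw [h.a_t1 _ _ y1, h.a_t1 _ _ v1]; linarith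
      · rw [h.c_t1 _ _ x0, h.c_t1 _ _ u0]; linarith
    rcases le_total x ρ with c4 | c4
    · exact h.cmp_mono (by linarith) (hs2 x u v y h0 h1 h2 hy1 c4 c3 (by linarith) hb.le h5)
    · obtain ⟨x', u', v', y', ex, eu, ev, ey, x0, x1, u0, u1, v0, v1, y0, y1, d1, d2, d3⟩ :=
        pull (ρ ^ 2) ρ hr2 le_rfl c4 (by linarith)
      subst ex eu ev ey
      refine ⟨d3, ?_, ?_⟩
      · rw [h.a_t2 _ _ y1, h.a_t2 _ _ v1]; linarith
      · rw [h.c_t2 _ _ x0, h.c_t2 _ _ u0]; linarith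

theorem GM.clip {p1 p2 : ℝ} (h : GM ρ p1 p2 m) (u v : ℝ) :
    m u v ≤ m (max 0 u) (min 1 v) := by
  have e1 : m u v ≤ m (max 0 u) v := by
    rcases le_total 0 u with h0 | h0
    · rw [max_eq_right h0]
    · rw [max_eq_left h0]
      have := h.sub u 0 v
      rw [h.z0 u 0 le_rfl] at this; linarith
  refine e1.trans ?_
  rcases le_total 1 v with h0 | h0
  · rw [min_eq_left h0]
    have := h.sub (max 0 u) 1 v
    rw [h.z1 1 v le_rfl] at this; linarith
  · rw [min_eq_right h0]

theorem GM.doubling (h : GM ρ (1/2) (1/2) m) : ∃ C, 0 ≤ C ∧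
    ∀ x r, 0 ≤ x → x ≤ 1 → 0 < r → m (x - 2 * r) (x + 2 * r) ≤ C * m (x - r) (x + r) := by
  obtain ⟨C, hC0, hC⟩ := h.compare (1/4) (by norm_num)
  refine ⟨C, hC0, fun x r h0 h1 hr => ?_⟩
  refine (h.clip _ _).trans ?_
  have a1 : max 0 (x - 2 * r) ≤ max 0 (x - r) := max_le_max le_rfl (by linarith)
  have a2 : min 1 (x + r) ≤ min 1 (x + 2 * r) := min_le_min le_rfl (by linarith)
  have b1 : max 0 (x - r) ≤ x := max_le h0 (by linarith)
  have b2 : x ≤ min 1 (x + r) := le_min h1 (by linarith)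
  have key : 1 / 4 * (min 1 (x + 2 * r) - max 0 (x - 2 * r))
      ≤ min 1 (x + r) - max 0 (x - r) := by
    have c1 : min 1 (x + 2 * r) ≤ 1 := min_le_left _ _
    have c2 : min 1 (x + 2 * r) ≤ x + 2 * r := min_le_right _ _
    have c3 : 0 ≤ max 0 (x - 2 * r) := le_max_left _ _
    have c4 : x - 2 * r ≤ max 0 (x - 2 * r) := le_max_right _ _
    rcases le_total 1 (x + r) with h2 | h2
    · rw [min_eq_left h2]
      rcases le_total 0 (x - r) with h3 | h3
      · rw [max_eq_right h3]; linarith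
      · rw [max_eq_left h3]; linarith
    · rw [min_eq_right h2]; linarith
  have pos : 0 < min 1 (x + 2 * r) - max 0 (x - 2 * r) := by
    rcases eq_or_lt_of_le h1 with h2 | h2
    · have : max 0 (x - 2 * r) < x := max_lt (by linarith) (by linarith)
      linarith
    · have : x < min 1 (x + 2 * r) := lt_min h2 (by linarith)
      linarith
  have hr2 : ρ ^ 2 < 1 := by nlinarith [h.hρ, h.hρ1]
  obtain ⟨n, hn⟩ := exists_pow_lt_of_lt_one pos hr2
  obtain ⟨e, -, -⟩ := hC n _ _ _ _ (le_max_left _ _) a1 (b1.trans b2) a2 (min_le_left _ _) hn.le key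
  exact e.trans (mul_le_mul_of_nonneg_left
    (h.mono _ _ _ _ (le_max_right _ _) (min_le_right _ _)) hC0)

end

section
variable {β p1 p2 : ℝ} {μ : Measure ℝ}

theorem smap_zero (β x : ℝ) : Smap β 0 x = x / β := by simp [Smap]
theorem smap_one (β x : ℝ) : Smap β 1 x = x / β + (1 - 1 / β) := by simp [Smap]

theorem smap_meas (β : ℝ) (i : Fin 2) : Measurable (Smap β i) := by
  unfold Smap
  split_ifs
  · exact measurable_id.div_const β
  · exact (measurable_id.div_const β).add_const _

theorem mu_real [IsProbabilityMeasure μ] (hp1 : 0 < p1) (hp2 : 0 < p2)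
    (hμ : μ = ENNReal.ofReal p1 • μ.map (Smap β 0) + ENNReal.ofReal p2 • μ.map (Smap β 1))
    (A : Set ℝ) (hA : MeasurableSet A) :
    μ.real A = p1 * μ.real (Smap β 0 ⁻¹' A) + p2 * μ.real (Smap β 1 ⁻¹' A) := by
  have e : μ A = ENNReal.ofReal p1 * μ (Smap β 0 ⁻¹' A) + ENNReal.ofReal p2 * μ (Smap β 1 ⁻¹' A) := by
    conv_lhs => rw [hμ]
    simp only [Measure.add_apply, Measure.smul_apply, smul_eq_mul]
    rw [Measure.map_apply (smap_meas β 0) hA, Measure.map_apply (smap_meas β 1) hA]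
  unfold Measure.real
  rw [e, ENNReal.toReal_add (by finiteness) (by finiteness), ENNReal.toReal_mul,
    ENNReal.toReal_mul, ENNReal.toReal_ofReal hp1.le, ENNReal.toReal_ofReal hp2.le]

theorem mu_out [IsProbabilityMeasure μ] (hβ1 : 1 < β) (hp1 : 0 < p1) (hp2 : 0 < p2)
    (hp : p1 + p2 = 1)
    (hμ : μ = ENNReal.ofReal p1 • μ.map (Smap β 0) + ENNReal.ofReal p2 • μ.map (Smap β 1)) :
    μ.real (Set.Icc 0 1)ᶜ = 0 := by
  have hb : 0 < β := by linarith
  let A : ℝ → Set ℝ := fun s => (Set.Icc (-s) (1 + s))ᶜ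
  have step : ∀ s, 0 ≤ s → μ.real (A s) ≤ μ.real (A (β * s)) := by
    intro s hs
    rw [mu_real hp1 hp2 hμ (A s) measurableSet_Icc.compl]
    have i0 : Smap β 0 ⁻¹' (A s) ⊆ A (β * s) := by
      intro x hx hx'
      apply hx
      rw [smap_zero]
      refine ⟨?_, ?_⟩
      · rw [le_div_iff₀ hb]; linarith [hx'.1]
      · rw [div_le_iff₀ hb]; linarith [hx'.2]
    have i1 : Smap β 1 ⁻¹' (A s) ⊆ A (β * s) := by
      intro x hx hx'
      apply hx
      have e : x / β + (1 - 1 / β) = (x + β - 1) / β := by field_simp; ring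
      rw [smap_one, e]
      refine ⟨?_, ?_⟩
      · rw [le_div_iff₀ hb]; linarith [hx'.1]
      · rw [div_le_iff₀ hb]; linarith [hx'.2]
    have j0 := measureReal_mono (μ := μ) i0
    have j1 := measureReal_mono (μ := μ) i1
    calc _ ≤ p1 * μ.real (A (β * s)) + p2 * μ.real (A (β * s)) := by gcongr
      _ = _ := by rw [← add_mul, hp, one_mul]
  have stepn : ∀ s, 0 < s → ∀ n : ℕ, μ.real (A s) ≤ μ.real (A (β ^ n * s)) := by
    intro s hs n
    induction n with
    | zero => simp
    | succ n ih =>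
      refine ih.trans ?_
      rw [pow_succ', mul_assoc]
      exact step _ (by positivity)
  have zero : ∀ s, 0 < s → μ (A s) = 0 := by
    intro s hs
    have lim : Filter.Tendsto (fun n : ℕ => μ (A (β ^ n * s))) Filter.atTop (nhds (μ (⋂ n : ℕ, A (β ^ n * s)))) := by
      apply tendsto_measure_iInter_atTop
      · exact fun n => measurableSet_Icc.compl.nullMeasurableSet
      · intro a b hab
        have : β ^ a * s ≤ β ^ b * s := by gcongr; exact hβ1.le
        exact Set.compl_subset_compl.mpr (Set.Icc_subset_Icc (by linarith) (by linarith))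
      · exact ⟨0, by finiteness⟩
    have emp : (⋂ n : ℕ, A (β ^ n * s)) = ∅ := by
      rw [Set.eq_empty_iff_forall_notMem]
      intro x hx
      rw [Set.mem_iInter] at hx
      obtain ⟨n, hn⟩ := pow_unbounded_of_one_lt (|x| / s) hβ1
      rw [div_lt_iff₀ hs] at hn
      apply hx n
      constructor <;> linarith [neg_abs_le x, le_abs_self x]
    rw [emp, measure_empty] at lim
    refine le_antisymm (ge_of_tendsto lim ?_) bot_le
    refine Filter.Eventually.of_forall fun n => ?_
    have := stepn s hs n
    unfold Measure.real at this
    rwa [ENNReal.toReal_le_toReal (by finiteness) (by finiteness)] at this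
  have sub : (Set.Icc (0:ℝ) 1)ᶜ ⊆ ⋃ n : ℕ, A (1 / ((n : ℝ) + 1)) := by
    intro x hx
    rw [Set.mem_iUnion]
    by_contra hcon
    push Not at hcon
    apply hx
    have hc : ∀ n : ℕ, x ∈ Set.Icc (-(1 / ((n : ℝ) + 1))) (1 + 1 / ((n : ℝ) + 1)) := fun n => by
      have := hcon n
      simpa only [A, Set.mem_compl_iff, not_not] using this
    constructor
    · by_contra hn
      push Not at hn
      obtain ⟨n, hn'⟩ := exists_nat_one_div_lt (show 0 < -x by linarith)
      linarith [(hc n).1]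
    · by_contra hn
      push Not at hn
      obtain ⟨n, hn'⟩ := exists_nat_one_div_lt (show 0 < x - 1 by linarith)
      linarith [(hc n).2]
  have : μ (Set.Icc (0:ℝ) 1)ᶜ = 0 := by
    refine measure_mono_null sub ?_
    rw [measure_iUnion_null_iff]
    exact fun n => zero _ (by positivity)
  simp [Measure.real, this]

theorem mu_gm [IsProbabilityMeasure μ] (hβ1 : 1 < β) (hβ : β ^ 2 = β + 1)
    (hp1 : 0 < p1) (hp2 : 0 < p2) (hp : p1 + p2 = 1)
    (hμ : μ = ENNReal.ofReal p1 • μ.map (Smap β 0) + ENNReal.ofReal p2 • μ.map (Smap β 1)) :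
    GM (β - 1) p1 p2 (fun u v => μ.real (Set.Icc u v)) := by
  have hb : 0 < β := by linarith
  have out := mu_out hβ1 hp1 hp2 hp hμ
  have inv : (β - 1) * β = 1 := by linear_combination hβ
  have hinv : 1 / β = β - 1 := by rw [div_eq_iff hb.ne', inv]
  have ss : ∀ u v, μ.real (Set.Icc ((β - 1) * u) ((β - 1) * v)) = p1 * μ.real (Set.Icc u v)
      + p2 * μ.real (Set.Icc (u - (β - 1)) (v - (β - 1))) := by
    intro u v
    rw [mu_real hp1 hp2 hμ _ measurableSet_Icc]
    have e0 : Smap β 0 ⁻¹' (Set.Icc ((β - 1) * u) ((β - 1) * v)) = Set.Icc u v := by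
      ext x
      have : x / β = (β - 1) * x := by rw [← hinv]; ring
      simp only [Set.mem_preimage, smap_zero, Set.mem_Icc, this]
      have : 0 < β - 1 := by linarith
      rw [mul_le_mul_iff_right₀ this, mul_le_mul_iff_right₀ this]
    have e1 : Smap β 1 ⁻¹' (Set.Icc ((β - 1) * u) ((β - 1) * v))
        = Set.Icc (u - (β - 1)) (v - (β - 1)) := by
      ext x
      have : x / β + (1 - 1 / β) = (β - 1) * (x + (β - 1)) := by
        rw [hinv, div_eq_mul_one_div, hinv]; linear_combination -hβ
      simp only [Set.mem_preimage, smap_one, Set.mem_Icc, this]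
      have : 0 < β - 1 := by linarith
      rw [mul_le_mul_iff_right₀ this, mul_le_mul_iff_right₀ this, sub_le_iff_le_add, le_sub_iff_add_le]
    rw [e0, e1]
  have sub : ∀ u v w, μ.real (Set.Icc u w) ≤ μ.real (Set.Icc u v) + μ.real (Set.Icc v w) := by
    intro u v w
    refine le_trans (measureReal_mono ?_) (measureReal_union_le _ _)
    intro x hx
    rcases le_total x v with h | h
    · exact Or.inl ⟨hx.1, h⟩
    · exact Or.inr ⟨h, hx.2⟩
  have outs : ∀ B : Set ℝ, (∀ x ∈ B, x < 0 ∨ 1 < x) → μ.real B = 0 := by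
    intro B hB
    refine le_antisymm (le_trans (measureReal_mono ?_) out.le) measureReal_nonneg
    intro x hx hx'
    rcases hB x hx with h | h
    · linarith [hx'.1]
    · linarith [hx'.2]
  have at0 : μ.real (Set.Icc 0 0) = 0 := by
    have := ss 0 0
    rw [outs (Set.Icc (0 - (β - 1)) (0 - (β - 1))) (fun x hx => Or.inl (by linarith [hx.2]))] at this
    rw [mul_zero, mul_zero, add_zero] at this
    have h2 : p2 * μ.real (Set.Icc (0:ℝ) 0) = 0 := by linear_combination this + hp * μ.real (Set.Icc (0:ℝ) 0)
    rcases mul_eq_zero.mp h2 with h | h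
    · linarith
    · exact h
  have at1 : μ.real (Set.Icc 1 1) = 0 := by
    have := ss β β
    rw [outs (Set.Icc β β) (fun x hx => Or.inr (by linarith [hx.1])), inv, sub_sub_cancel] at this
    rw [mul_zero, zero_add] at this
    have h2 : p1 * μ.real (Set.Icc (1:ℝ) 1) = 0 := by linear_combination this + hp * μ.real (Set.Icc (1:ℝ) 1)
    rcases mul_eq_zero.mp h2 with h | h
    · linarith
    · exact h
  exact
  { hρ := by linarith
    hρ1 := by nlinarith
    sq := by linear_combination hβ
    hp1 := hp1
    hp2 := hp2
    hp := hp
    ss := ss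
    z0 := fun u v hv => by
      refine le_antisymm ?_ measureReal_nonneg
      have e : μ.real (Set.Icc (0:ℝ) 0) + μ.real (Set.Iio 0) ≤ 0 := by
        rw [at0, outs (Set.Iio 0) (fun x hx => Or.inl hx), add_zero]
      refine le_trans (le_trans (measureReal_mono ?_) (measureReal_union_le _ _)) e
      intro x hx
      rcases lt_or_eq_of_le (hx.2.trans hv) with h | h
      · exact Or.inr h
      · exact Or.inl ⟨h.ge, h.le⟩
    z1 := fun u v hv => by
      refine le_antisymm ?_ measureReal_nonneg
      have e : μ.real (Set.Icc (1:ℝ) 1) + μ.real (Set.Ioi 1) ≤ 0 := by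
        rw [at1, outs (Set.Ioi 1) (fun x hx => Or.inr hx), add_zero]
      refine le_trans (le_trans (measureReal_mono ?_) (measureReal_union_le _ _)) e
      intro x hx
      rcases lt_or_eq_of_le (hv.trans hx.1) with h | h
      · exact Or.inr h
      · exact Or.inl ⟨h.le, h.ge⟩
    nn := fun u v => measureReal_nonneg
    mono := fun u v u' v' h1 h2 => measureReal_mono (Set.Icc_subset_Icc h1 h2)
    sub := sub
    one := by
      have := probReal_add_probReal_compl (μ := μ) (measurableSet_Icc (a := (0:ℝ)) (b := 1))
      linarith
    le1 := fun u v => measureReal_le_one }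

end

/-- For `m = 2` (golden ratio), `μ_p` is doubling iff `p₁ = p₂ = 1/2`. -/
theorem stmt_1 (β : ℝ) (hβ1 : 1 < β) (hβ2 : β < 2)
    (hβ : β ^ 2 = ∑ j ∈ Finset.range 2, β ^ j)
    (p1 p2 : ℝ) (hp1 : 0 < p1) (hp2 : 0 < p2) (hp : p1 + p2 = 1)
    (μ : Measure ℝ) [IsProbabilityMeasure μ]
    (hμ : μ = ENNReal.ofReal p1 • μ.map (Smap β 0) + ENNReal.ofReal p2 • μ.map (Smap β 1)) :
    IsDoubling μ ↔ (p1 = 1/2 ∧ p2 = 1/2) := by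
  have hβ' : β ^ 2 = β + 1 := by
    rw [hβ, Finset.sum_range_succ, Finset.sum_range_one]; ring
  have G := mu_gm hβ1 hβ' hp1 hp2 hp hμ
  constructor
  · intro hd
    unfold IsDoubling at hd
    set C := (⨆ (x : ℝ) (_ : x ∈ Set.Icc (0:ℝ) 1) (r : ℝ) (_ : 0 < r),
      μ (Metric.closedBall x (2 * r)) / μ (Metric.closedBall x r)) with hC
    have key : p1 = p2 := by
      apply G.not_doubling C.toReal ENNReal.toReal_nonneg
      intro x r h0 h1 hr
      have hle : μ (Metric.closedBall x (2 * r)) / μ (Metric.closedBall x r) ≤ C := by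
        rw [hC]
        exact le_iSup₂_of_le x ⟨h0, h1⟩ (le_iSup₂_of_le r hr le_rfl)
      rw [ENNReal.div_le_iff_le_mul (Or.inr hd.ne) (Or.inl (by finiteness))] at hle
      have := ENNReal.toReal_mono (by finiteness) hle
      rw [ENNReal.toReal_mul, Real.closedBall_eq_Icc, Real.closedBall_eq_Icc] at this
      exact this
    constructor <;> linarith
  · rintro ⟨rfl, rfl⟩
    obtain ⟨C, hC0, hC⟩ := G.doubling
    unfold IsDoubling
    refine lt_of_le_of_lt (b := ENNReal.ofReal C) ?_ ENNReal.ofReal_lt_top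
    refine iSup₂_le fun x hx => iSup₂_le fun r hr => ?_
    apply ENNReal.div_le_of_le_mul
    rw [Real.closedBall_eq_Icc, Real.closedBall_eq_Icc,
      ← ENNReal.ofReal_toReal (measure_ne_top μ (Set.Icc (x - 2 * r) (x + 2 * r))),
      ← ENNReal.ofReal_toReal (measure_ne_top μ (Set.Icc (x - r) (x + r))),
      ← ENNReal.ofReal_mul hC0]
    exact ENNReal.ofReal_le_ofReal (hC x r hx.1 hx.2 hr)
end
end

section
/- For every k ≥ 1, X_{k+1} = X_k ∪ { x + d₁·β^{−(k+1)} : x ∈ X_k, x ≠ 1 }. -/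
open MeasureTheory

noncomputable section

theorem Sapply_last (β : ℝ) (hβ1 : 1 < β) (n : ℕ) (I : Fin (n+1) → Fin 2) :
    Sapply β I 0 = Sapply β (fun j : Fin n => I j.castSucc) 0 +
      (if I (Fin.last n) = 0 then 0 else (β - 1) * (β ^ (n+1))⁻¹) := by
  have h0 : β ≠ 0 := by positivity
  induction n with
  | zero =>
    simp only [Sapply, Smap]
    have : (Fin.last 0) = (0 : Fin 1) := rfl
    rw [this]
    split_ifs
    · simp
    · field_simp
      ring
  | succ n ih =>
    have h1 : Sapply β I 0 = Smap β (I 0) (Sapply β (fun k => I k.succ) 0) := rfl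
    have h2 : Sapply β (fun j : Fin (n+1) => I j.castSucc) 0
        = Smap β (I 0) (Sapply β (fun k : Fin n => I k.succ.castSucc) 0) := rfl
    rw [h1, h2, ih]
    simp only [Fin.succ_last, Fin.succ_castSucc]
    simp only [Smap]
    split_ifs <;> field_simp <;> ring

theorem Sapply_lt_one (β : ℝ) (hβ1 : 1 < β) (n : ℕ) (I : Fin n → Fin 2) :
    Sapply β I 0 < 1 := by
  have h0 : 0 < β := by linarith
  induction n with
  | zero => simp [Sapply]
  | succ n ih =>
    have h := ih (fun k => I k.succ)
    have h3 : Sapply β (fun k => I k.succ) 0 / β < 1 / β := by gcongr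
    have h4 : 1 / β < 1 := by rw [div_lt_one h0]; exact hβ1
    simp only [Sapply, Smap]
    split_ifs <;> linarith

/-- `X_{k+1} = X_k ∪ { x + d₁·β^{-(k+1)} : x ∈ X_k, x ≠ 1 }` for `k ≥ 1`. -/
theorem stmt_3 (m : ℕ) (hm : 2 ≤ m) (β : ℝ) (hβ1 : 1 < β) (hβ2 : β < 2)
    (hβ : β ^ m = ∑ j ∈ Finset.range m, β ^ j)
    (k : ℕ) (hk : 1 ≤ k) :
    Xn β (k+1) =
      Xn β k ∪ ((Xn β k).filter (fun x => x ≠ 1)).image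
        (fun x => x + dd β 1 * (β ^ (k+1))⁻¹) := by
  ext y
  simp only [Xn, Finset.mem_union, Finset.mem_image, Finset.mem_filter, Finset.mem_univ,
    true_and, Finset.mem_singleton, dd]
  constructor
  · rintro (⟨I, rfl⟩ | h)
    · rw [Sapply_last β hβ1]
      split_ifs
      · left; left
        exact ⟨_, (add_zero _).symm⟩
      · right
        exact ⟨_, ⟨Or.inl ⟨_, rfl⟩, (Sapply_lt_one β hβ1 _ _).ne⟩, rfl⟩
    · exact Or.inl (Or.inr h)
  · rintro ((⟨I, rfl⟩ | h) | ⟨x, ⟨⟨I, rfl⟩ | h, hx⟩, rfl⟩)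
    · left
      refine ⟨Fin.snoc (α := fun _ => Fin 2) I 0, ?_⟩
      rw [Sapply_last β hβ1]
      simp
    · exact Or.inr h
    · left
      refine ⟨Fin.snoc (α := fun _ => Fin 2) I 1, ?_⟩
      rw [Sapply_last β hβ1]
      simp
    · exact absurd h hx
end
end
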